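/- Under assumptions (A1)-(A3), for each pair of class labels 1 ≤ j, i ≤ J and for independent random vectors X ~ F_j^{(d)} and Y ~ F_i^{(d)}, the sequence ‖X − Y‖²/d converges in probability to σ_j² + σ_i² + ν_{ji}² as d → ∞ (where ν_{jj}² = 0). -/

import Mathlib

open MeasureTheory ProbabilityTheory Filter

/-- The covariance of two real-valued functions under a measure. -/
noncomputable def pCov {α : Type*} [MeasurableSpace α] (μ : Measure α) (f g : α → ℝ) : ℝ :=
  (∫ x, f x * g x ∂μ) - (∫ x, f x ∂μ) * (∫ x, g x ∂μ)

/-- The correlation of two real-valued functions under a measure. -/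
noncomputable def pCorr {α : Type*} [MeasurableSpace α] (μ : Measure α) (f g : α → ℝ) : ℝ :=
  pCov μ f g / (Real.sqrt (pCov μ f f) * Real.sqrt (pCov μ g g))

lemma cov_zero_of_var {α : Type*} [MeasurableSpace α] {μ : Measure α} [IsProbabilityMeasure μ]
    {f g : α → ℝ} (hf : MemLp f 2 μ) (h : Var[f; μ] = 0) : cov[f, g; μ] = 0 := by
  have h1 := ae_eq_integral_of_variance_eq_zero hf h
  unfold covariance
  rw [integral_eq_zero_of_ae]
  filter_upwards [h1] with x hx
  simp [hx]

lemma pCov_eq {α : Type*} [MeasurableSpace α] {μ : Measure α} [IsProbabilityMeasure μ]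
    {f g : α → ℝ} (hf : MemLp f 2 μ) (hg : MemLp g 2 μ) : pCov μ f g = cov[f, g; μ] := by
  rw [covariance_eq_sub hf hg]; rfl

lemma cov_le_corr {α : Type*} [MeasurableSpace α] {μ : Measure α} [IsProbabilityMeasure μ]
    {f g : α → ℝ} (hf : MemLp f 2 μ) (hg : MemLp g 2 μ) {K : ℝ}
    (hfK : Var[f; μ] ≤ K) (hgK : Var[g; μ] ≤ K) :
    cov[f, g; μ] ≤ K * |pCorr μ f g| := by
  have hK : 0 ≤ K := (variance_nonneg f μ).trans hfK
  unfold pCorr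
  rw [pCov_eq hf hg, pCov_eq hf hf, pCov_eq hg hg, covariance_self hf.aemeasurable,
    covariance_self hg.aemeasurable]
  rcases (variance_nonneg f μ).eq_or_lt with h | h
  · rw [cov_zero_of_var hf h.symm]; positivity
  rcases (variance_nonneg g μ).eq_or_lt with h' | h'
  · rw [covariance_comm, cov_zero_of_var hg h'.symm]; positivity
  have hs : 0 < √Var[f; μ] * √Var[g; μ] := by positivity
  have hle : √Var[f; μ] * √Var[g; μ] ≤ K := by
    calc _ ≤ √K * √K := by gcongr
      _ = K := Real.mul_self_sqrt hK
  rw [abs_div, abs_of_pos hs]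
  calc cov[f, g; μ] ≤ |cov[f, g; μ]| := le_abs_self _
    _ = (√Var[f; μ] * √Var[g; μ]) * (|cov[f, g; μ]| / (√Var[f; μ] * √Var[g; μ])) := by
      field_simp
    _ ≤ _ := by gcongr

section fixed
variable {d : ℕ} {μ ν : Measure (EuclideanSpace ℝ (Fin d))}
  [IsProbabilityMeasure μ] [IsProbabilityMeasure ν]

lemma memLp_sq (h : ∀ q, Integrable (fun x => (x q) ^ 4) μ) (q : Fin d) :
    MemLp (fun x : EuclideanSpace ℝ (Fin d) => (x q) ^ 2) 2 μ := by
  rw [memLp_two_iff_integrable_sq (by fun_prop)]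
  refine (h q).congr (Eventually.of_forall fun x => ?_)
  simp only; ring

lemma memLp_coord (h : ∀ q, Integrable (fun x => (x q) ^ 4) μ) (q : Fin d) :
    MemLp (fun x : EuclideanSpace ℝ (Fin d) => x q) 2 μ := by
  rw [memLp_two_iff_integrable_sq (by fun_prop)]
  exact (memLp_sq h q).integrable one_le_two

lemma int_fst {f : EuclideanSpace ℝ (Fin d) → ℝ} :
    ∫ p, f p.1 ∂(μ.prod ν) = ∫ x, f x ∂μ := by
  simpa using integral_prod_mul (μ := μ) (ν := ν) f (fun _ => (1 : ℝ))

lemma int_snd {f : EuclideanSpace ℝ (Fin d) → ℝ} :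
    ∫ p, f p.2 ∂(μ.prod ν) = ∫ x, f x ∂ν := by
  simpa using integral_prod_mul (μ := μ) (ν := ν) (fun _ => (1 : ℝ)) f

lemma four_bound (a b : ℝ) : ((a - b) ^ 2) ^ 2 ≤ 8 * (a ^ 4 + b ^ 4) := by
  have h1 : (a - b) ^ 2 ≤ 2 * (a ^ 2 + b ^ 2) := by nlinarith [sq_nonneg (a + b)]
  calc ((a - b) ^ 2) ^ 2 ≤ (2 * (a ^ 2 + b ^ 2)) ^ 2 := by gcongr
    _ ≤ _ := by nlinarith [sq_nonneg (a ^ 2 - b ^ 2)]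

lemma int_bound (h : ∀ q, Integrable (fun x => (x q) ^ 4) μ)
    (h' : ∀ q, Integrable (fun x => (x q) ^ 4) ν) (q : Fin d) :
    Integrable (fun p : EuclideanSpace ℝ (Fin d) × EuclideanSpace ℝ (Fin d) =>
      8 * ((p.1 q) ^ 4 + (p.2 q) ^ 4)) (μ.prod ν) :=
  (((h q).comp_fst ν).add ((h' q).comp_snd μ)).const_mul 8

lemma memLp_V (h : ∀ q, Integrable (fun x => (x q) ^ 4) μ)
    (h' : ∀ q, Integrable (fun x => (x q) ^ 4) ν) (q : Fin d) :
    MemLp (fun p : EuclideanSpace ℝ (Fin d) × EuclideanSpace ℝ (Fin d) =>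
      (p.1 q - p.2 q) ^ 2) 2 (μ.prod ν) := by
  rw [memLp_two_iff_integrable_sq (by fun_prop)]
  refine (int_bound h h' q).mono' (by fun_prop) (Eventually.of_forall fun p => ?_)
  rw [Real.norm_of_nonneg (by positivity)]
  exact four_bound _ _

lemma var_V (h : ∀ q, Integrable (fun x => (x q) ^ 4) μ)
    (h' : ∀ q, Integrable (fun x => (x q) ^ 4) ν) {M : ℝ}
    (hM : ∀ q, (∫ x, (x q) ^ 4 ∂μ) ≤ M) (hM' : ∀ q, (∫ x, (x q) ^ 4 ∂ν) ≤ M) (q : Fin d) :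
    Var[fun p : EuclideanSpace ℝ (Fin d) × EuclideanSpace ℝ (Fin d) =>
      (p.1 q - p.2 q) ^ 2; μ.prod ν] ≤ 16 * M := by
  refine (variance_le_expectation_sq (by fun_prop)).trans ?_
  calc _ ≤ ∫ p, 8 * ((p.1 q) ^ 4 + (p.2 q) ^ 4) ∂(μ.prod ν) := by
        refine integral_mono ((memLp_V h h' q).integrable_sq) (int_bound h h' q) fun p => ?_
        exact four_bound _ _
    _ = 8 * ((∫ x, (x q) ^ 4 ∂μ) + ∫ x, (x q) ^ 4 ∂ν) := by
        rw [integral_const_mul, integral_add ((h q).comp_fst ν) ((h' q).comp_snd μ),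
          int_fst (f := fun x => (x q) ^ 4), int_snd (f := fun x => (x q) ^ 4)]
    _ ≤ _ := by linarith [hM q, hM' q]

lemma norm_sq_sum (x : EuclideanSpace ℝ (Fin d)) : ‖x‖ ^ 2 = ∑ q, (x q) ^ 2 := by
  rw [EuclideanSpace.real_norm_sq_eq]

lemma memLp_S (h : ∀ q, Integrable (fun x => (x q) ^ 4) μ)
    (h' : ∀ q, Integrable (fun x => (x q) ^ 4) ν) :
    MemLp (fun p : EuclideanSpace ℝ (Fin d) × EuclideanSpace ℝ (Fin d) =>
      ‖p.1 - p.2‖ ^ 2) 2 (μ.prod ν) := by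
  simp only [norm_sq_sum, PiLp.sub_apply]
  exact memLp_finset_sum _ fun q _ => memLp_V h h' q

lemma var_S (h : ∀ q, Integrable (fun x => (x q) ^ 4) μ)
    (h' : ∀ q, Integrable (fun x => (x q) ^ 4) ν) {M : ℝ}
    (hM : ∀ q, (∫ x, (x q) ^ 4 ∂μ) ≤ M) (hM' : ∀ q, (∫ x, (x q) ^ 4 ∂ν) ≤ M) :
    Var[fun p : EuclideanSpace ℝ (Fin d) × EuclideanSpace ℝ (Fin d) =>
      ‖p.1 - p.2‖ ^ 2; μ.prod ν] ≤ 16 * M * (d + ∑ r : Fin d, ∑ s : Fin d, if r ≠ s then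
            |pCorr (μ.prod ν)
              (fun p => (p.1 r - p.2 r) ^ 2) (fun p => (p.1 s - p.2 s) ^ 2)|
          else 0) := by
  simp only [norm_sq_sum, PiLp.sub_apply]
  rw [variance_fun_sum fun q => memLp_V h h' q]
  have : (d : ℝ) = ∑ r : Fin d, ∑ s : Fin d, if r = s then (1 : ℝ) else 0 := by simp
  conv_rhs => enter [2, 1]; rw [this]
  rw [← Finset.sum_add_distrib, Finset.mul_sum]
  refine Finset.sum_le_sum fun r _ => ?_
  rw [← Finset.sum_add_distrib, Finset.mul_sum]
  refine Finset.sum_le_sum fun s _ => ?_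
  by_cases hrs : r = s
  · subst hrs
    rw [covariance_self (memLp_V h h' r).aemeasurable]
    simpa using var_V h h' hM hM' r
  · simpa [hrs] using cov_le_corr (memLp_V h h' r) (memLp_V h h' s)
      (var_V h h' hM hM' r) (var_V h h' hM hM' s)

lemma trace_eq (h : ∀ q, Integrable (fun x => (x q) ^ 4) μ) :
    ∫ x, ‖x - ∫ y, y ∂μ‖ ^ 2 ∂μ = ∑ q, Var[fun x => x q; μ] := by
  have hm : ∀ q, (∫ y, y ∂μ) q = ∫ y, y q ∂μ := fun q =>
    eval_integral_piLp (fun q => (memLp_coord h q).integrable one_le_two) q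
  simp only [norm_sq_sum, PiLp.sub_apply, hm]
  rw [integral_finset_sum]
  · refine Finset.sum_congr rfl fun q _ => ?_
    rw [variance_eq_integral (by fun_prop)]
  · intro q _
    exact ((memLp_coord h q).sub (memLp_const _)).integrable_sq

lemma mean_S (h : ∀ q, Integrable (fun x => (x q) ^ 4) μ)
    (h' : ∀ q, Integrable (fun x => (x q) ^ 4) ν) :
    ∫ p, ‖p.1 - p.2‖ ^ 2 ∂(μ.prod ν) = (∫ x, ‖x - ∫ y, y ∂μ‖ ^ 2 ∂μ)
      + (∫ x, ‖x - ∫ y, y ∂ν‖ ^ 2 ∂ν) + ‖(∫ y, y ∂μ) - ∫ y, y ∂ν‖ ^ 2 := by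
  have hm : ∀ q, (∫ y, y ∂μ) q = ∫ y, y q ∂μ := fun q =>
    eval_integral_piLp (fun q => (memLp_coord h q).integrable one_le_two) q
  have hm' : ∀ q, (∫ y, y ∂ν) q = ∫ y, y q ∂ν := fun q =>
    eval_integral_piLp (fun q => (memLp_coord h' q).integrable one_le_two) q
  rw [trace_eq h, trace_eq h', norm_sq_sum ((∫ y, y ∂μ) - ∫ y, y ∂ν)]
  simp only [norm_sq_sum, PiLp.sub_apply, hm, hm']
  rw [integral_finset_sum _ fun q _ => (memLp_V h h' q).integrable one_le_two,
    ← Finset.sum_add_distrib, ← Finset.sum_add_distrib]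
  refine Finset.sum_congr rfl fun q _ => ?_
  have hX := memLp_coord h q
  have hY := memLp_coord h' q
  have hX1 := hX.comp_fst ν
  have hY1 := hY.comp_snd μ
  have hv : Var[fun p : EuclideanSpace ℝ (Fin d) × EuclideanSpace ℝ (Fin d) =>
      p.1 q - p.2 q; μ.prod ν] = Var[fun x => x q; μ] + Var[fun x => x q; ν] := by
    have := variance_add_prod hX hY.neg
    rw [variance_neg] at this
    rw [← this]
    congr 1
  have hs := variance_eq_sub (hX1.sub hY1)
  have hs2 : Var[fun p : EuclideanSpace ℝ (Fin d) × EuclideanSpace ℝ (Fin d) =>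
      p.1 q - p.2 q; μ.prod ν] = (∫ p, (p.1 q - p.2 q) ^ 2 ∂(μ.prod ν))
      - (∫ p, (p.1 q - p.2 q) ∂(μ.prod ν)) ^ 2 := hs
  rw [← hv, hs2]
  have he : ∫ p, (p.1 q - p.2 q) ∂(μ.prod ν) = (∫ y, y q ∂μ) - ∫ y, y q ∂ν := by
    rw [integral_sub (hX1.integrable one_le_two) (hY1.integrable one_le_two),
      int_fst (f := fun x => x q), int_snd (f := fun x => x q)]
  rw [← he]
  simp
end fixed

/-- **Lemma 1.** Under (A1)-(A3), for independent `X ~ F j d` and `Y ~ F i d`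
(modelled via the product measure `(F j d).prod (F i d)`), the squared Euclidean
distance `‖X - Y‖² / d` converges in probability to `σ²_j + σ²_i + ν²_{ji}`
as the dimension `d → ∞`. -/
theorem mdist_stmt0
    (J : ℕ) (hJ : 2 ≤ J)
    (F : Fin J → (d : ℕ) → Measure (EuclideanSpace ℝ (Fin d)))
    [∀ j d, IsProbabilityMeasure (F j d)]
    -- coordinates have finite fourth moments
    (hmom : ∀ (j : Fin J) (d : ℕ) (q : Fin d), Integrable (fun x => (x q) ^ 4) (F j d))
    -- (A1): uniformly bounded fourth moments
    (M : ℝ)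
    (hA1 : ∀ (j : Fin J) (d : ℕ) (q : Fin d), (∫ x, (x q) ^ 4 ∂(F j d)) ≤ M)
    -- (A2): the sum over pairs r ≠ s of |Corr(U_r², U_s²)| is o(d²)
    (hA2 : ∀ j i : Fin J, Tendsto (fun d : ℕ =>
        (∑ r : Fin d, ∑ s : Fin d, if r ≠ s then
            |pCorr ((F j d).prod (F i d))
              (fun p => (p.1 r - p.2 r) ^ 2) (fun p => (p.1 s - p.2 s) ^ 2)|
          else 0) / (d : ℝ) ^ 2) atTop (nhds 0))
    -- (A3): limiting scaled trace of the covariance and scaled distance between means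
    (σ2 : Fin J → ℝ) (hσ2 : ∀ j, 0 ≤ σ2 j)
    (ν2 : Fin J → Fin J → ℝ) (hν2 : ∀ j i, 0 ≤ ν2 j i) (hν2diag : ∀ j, ν2 j j = 0)
    (hA3trace : ∀ j : Fin J, Tendsto (fun d : ℕ =>
        (∫ x, ‖x - (∫ y, y ∂(F j d))‖ ^ 2 ∂(F j d)) / (d : ℝ)) atTop (nhds (σ2 j)))
    (hA3mean : ∀ j i : Fin J, j ≠ i → Tendsto (fun d : ℕ =>
        ‖(∫ y, y ∂(F j d)) - (∫ y, y ∂(F i d))‖ ^ 2 / (d : ℝ)) atTop (nhds (ν2 j i)))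
    (j i : Fin J) :
    ∀ ε > (0 : ℝ), Tendsto (fun d : ℕ =>
        ((F j d).prod (F i d))
          {p | ε ≤ |‖p.1 - p.2‖ ^ 2 / (d : ℝ) - (σ2 j + σ2 i + ν2 j i)|})
      atTop (nhds 0) := by
  have hM : 0 ≤ M := (integral_nonneg fun x => by positivity).trans (hA1 j 1 0)
  have hmean : Tendsto (fun d : ℕ => (∫ p, ‖p.1 - p.2‖ ^ 2 ∂((F j d).prod (F i d))) / (d : ℝ))
      atTop (nhds (σ2 j + σ2 i + ν2 j i)) := by
    have h3 : Tendsto (fun d : ℕ =>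
        ‖(∫ y, y ∂(F j d)) - (∫ y, y ∂(F i d))‖ ^ 2 / (d : ℝ)) atTop (nhds (ν2 j i)) := by
      by_cases hji : j = i
      · subst hji; simp [hν2diag]
      · exact hA3mean j i hji
    refine (((hA3trace j).add (hA3trace i)).add h3).congr fun d => ?_
    rw [mean_S (hmom j d) (hmom i d)]
    ring
  intro ε hε
  have hb := ((tendsto_inv_atTop_nhds_zero_nat (𝕜 := ℝ)).add (hA2 j i)).const_mul
    (16 * M / (ε / 2) ^ 2)
  have hb2 := ENNReal.tendsto_ofReal hb
  simp only [add_zero, mul_zero, ENNReal.ofReal_zero] at hb2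
  refine tendsto_of_tendsto_of_tendsto_of_le_of_le' tendsto_const_nhds hb2
    (Eventually.of_forall fun _ => zero_le) ?_
  filter_upwards [eventually_gt_atTop 0,
    (Metric.tendsto_nhds.1 hmean) (ε / 2) (by positivity)] with d hd hdist
  have hd' : (0 : ℝ) < d := by exact_mod_cast hd
  rw [Real.dist_eq] at hdist
  have hL := memLp_S (hmom j d) (hmom i d)
  have hc := meas_ge_le_variance_div_sq hL (c := d * (ε / 2)) (by positivity)
  refine (measure_mono ?_).trans (hc.trans (ENNReal.ofReal_le_ofReal ?_))
  · intro p hp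
    simp only [Set.mem_setOf_eq] at hp ⊢
    set m := ∫ p, ‖p.1 - p.2‖ ^ 2 ∂((F j d).prod (F i d))
    have h1 := abs_sub_le (‖p.1 - p.2‖ ^ 2 / (d : ℝ)) (m / d) (σ2 j + σ2 i + ν2 j i)
    have h2 : ε / 2 ≤ |‖p.1 - p.2‖ ^ 2 / (d : ℝ) - m / d| := by linarith
    rw [← sub_div, abs_div, abs_of_pos hd', le_div_iff₀ hd'] at h2
    linarith
  · have hv := var_S (hmom j d) (hmom i d) (hA1 j d) (hA1 i d)
    rw [div_le_iff₀ (by positivity)]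
    refine hv.trans (le_of_eq ?_)
    field_simp
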